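/- Stable time-change of a sub-Gaussian diffusion kernel: (a) there exists C ≥ 1 such that for all t > 0 and x ≠ y with d(x,y) ≤ t^{β/α}: C^{-1} H_{≤1}(t, d(x,y)) ≤ q(t,x,y) ≤ C H_{≤1}(t, d(x,y)); (b) there exist constants c₁, c₂, c₃, c₄ > 0 such that for all t > 0 and x, y with d(x,y) ≥ t^{β/α}: c₁ t^{β−1−βd/α} exp(−c₂ (d(x,y)^α / t^β)^{1/(α−β)}) ≤ q(t,x,y) ≤ c₃ t^{β−1−βd/α} exp(−c₄ (d(x,y)^α / t^β)^{1/(α−β)}). -/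

import Mathlib

open MeasureTheory Filter Set
open scoped ENNReal Topology

/-- The on-diagonal/near-diagonal profile `H_{≤1}(t,r)` of Theorem 1.4. -/
noncomputable def Hle (α β d t r : ℝ) : ℝ :=
  if d < 2 * α then t ^ (β - 1 - β * d / α)
  else if d = 2 * α then t ^ (-1 - β) * Real.log (2 * t ^ β / r ^ α)
  else t ^ (-1 - β) * r ^ (2 * α - d)

/-- A finite measure on `[0, ∞)` is determined by its Laplace transform. -/
theorem measure_eq_of_laplace_eq (P Q : Measure ℝ) [IsFiniteMeasure P] [IsFiniteMeasure Q]
    (hP : P (Iio 0) = 0) (hQ : Q (Iio 0) = 0)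
    (h : ∀ l : ℝ, 0 < l → ∫ s, Real.exp (-l * s) ∂P = ∫ s, Real.exp (-l * s) ∂Q) :
    P = Q := by
  have nonneg_ae : ∀ M : Measure ℝ, M (Iio 0) = 0 → ∀ᵐ s ∂M, 0 ≤ s := fun M hM => by
    rw [ae_iff]; simpa [Iio] using hM
  have hinter : ∀ M : Measure ℝ, IsFiniteMeasure M → M (Iio 0) = 0 → ∀ l : ℝ, l < 0 →
      l ∈ interior (ProbabilityTheory.integrableExpSet id M) := by
    intro M _ hM l hl
    refine mem_interior.2 ⟨Iio 0, fun u hu => ?_, isOpen_Iio, hl⟩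
    refine Integrable.of_bound (by fun_prop) 1 ?_
    filter_upwards [nonneg_ae M hM] with s hs
    have hu' : u < 0 := hu
    simp only [Real.norm_eq_abs, Real.abs_exp, id]
    exact Real.exp_le_one_iff.2 (mul_nonpos_of_nonpos_of_nonneg hu'.le hs)
  have hset : IsPreconnected {z : ℂ | z.re < 0} :=
    (convex_halfSpace_re_lt 0).isPreconnected
  have han : ∀ M : Measure ℝ, IsFiniteMeasure M → M (Iio 0) = 0 →
      AnalyticOnNhd ℂ (ProbabilityTheory.complexMGF id M) {z : ℂ | z.re < 0} :=
    fun M hM hM0 z hz => ProbabilityTheory.analyticAt_complexMGF (hinter M hM hM0 _ hz)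
  have hneg : ∀ y : ℝ, y < 0 → ProbabilityTheory.complexMGF id P (y : ℂ) =
      ProbabilityTheory.complexMGF id Q (y : ℂ) := by
    intro y hy
    rw [ProbabilityTheory.complexMGF_ofReal, ProbabilityTheory.complexMGF_ofReal]
    have := h (-y) (by linarith)
    simp only [neg_neg] at this
    simp only [ProbabilityTheory.mgf, id, this]
  have heq : EqOn (ProbabilityTheory.complexMGF id P) (ProbabilityTheory.complexMGF id Q)
      {z : ℂ | z.re < 0} := by
    refine (han P inferInstance hP).eqOn_of_preconnected_of_frequently_eq
      (han Q inferInstance hQ) hset (z₀ := ((-1 : ℝ) : ℂ)) (by simp) ?_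
    have h_real : ∃ᶠ x : ℝ in 𝓝[≠] (-1), ProbabilityTheory.complexMGF id P (x : ℂ) =
        ProbabilityTheory.complexMGF id Q (x : ℂ) := by
      refine Eventually.frequently ?_
      filter_upwards [nhdsWithin_le_nhds (Iio_mem_nhds (show (-1 : ℝ) < 0 by norm_num))]
        with y hy using hneg y hy
    rw [frequently_iff_seq_forall] at h_real ⊢
    obtain ⟨xs, hx_tendsto, hx_eq⟩ := h_real
    refine ⟨fun n ↦ xs n, ?_, fun n ↦ hx_eq n⟩
    rw [tendsto_nhdsWithin_iff] at hx_tendsto ⊢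
    refine ⟨(Complex.continuous_ofReal.tendsto _).comp hx_tendsto.1, ?_⟩
    filter_upwards [hx_tendsto.2] with n hn
    simpa only [mem_compl_iff, mem_singleton_iff, Complex.ofReal_inj] using hn
  have hlim : ∀ M : Measure ℝ, IsFiniteMeasure M → M (Iio 0) = 0 → ∀ ξ : ℝ,
      Tendsto (fun n : ℕ => ProbabilityTheory.complexMGF id M
        (-(1 / ((n : ℝ) + 1) : ℝ) + ξ * Complex.I)) atTop (𝓝 (charFun M ξ)) := by
    intro M _ hM ξ
    rw [charFun_apply_real]
    unfold ProbabilityTheory.complexMGF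
    refine tendsto_integral_of_dominated_convergence (fun _ => 1) (fun n => ?_)
      (integrable_const _) (fun n => ?_) ?_
    · exact (by fun_prop : Measurable fun x : ℝ => Complex.exp
        ((-(1 / ((n : ℝ) + 1) : ℝ) + ξ * Complex.I) * ((id x : ℝ) : ℂ))).aestronglyMeasurable
    · filter_upwards [nonneg_ae M hM] with s hs
      rw [Complex.norm_exp]
      refine Real.exp_le_one_iff.2 ?_
      simp only [id, Complex.mul_re, Complex.add_re, Complex.neg_re, Complex.ofReal_re,
        Complex.I_re, Complex.ofReal_im, mul_zero, sub_zero, Complex.I_im, zero_mul, add_zero]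
      exact mul_nonpos_of_nonpos_of_nonneg (by simp; positivity) hs
    · refine ae_of_all _ fun s => ?_
      have h0 : Tendsto (fun n : ℕ => ((1 / ((n : ℝ) + 1) : ℝ) : ℂ)) atTop (𝓝 ((0 : ℝ) : ℂ)) :=
        (Complex.continuous_ofReal.tendsto 0).comp tendsto_one_div_add_atTop_nhds_zero_nat
      have h1 := ((h0.neg.add_const ((ξ : ℂ) * Complex.I)).mul_const ((s : ℝ) : ℂ)).cexp
      convert h1 using 2
      · rfl
      · simp only [Complex.ofReal_zero, neg_zero, zero_add]
        ring_nf
  refine Measure.ext_of_charFun (funext fun ξ => ?_)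
  refine tendsto_nhds_unique (hlim P inferInstance hP ξ) ?_
  refine (hlim Q inferInstance hQ ξ).congr fun n => (heq ?_).symm
  simp only [mem_ofPred_eq, Complex.add_re, Complex.neg_re, Complex.ofReal_re, Complex.mul_re,
    Complex.I_re, mul_zero, Complex.ofReal_im, Complex.I_im, mul_one, sub_self, add_zero]
  have : 0 < 1 / ((n : ℝ) + 1) := by positivity
  linarith

/-- The stable scaling relation: the densities at time `r` are rescalings of those at time `1`. -/
theorem stable_density_scaling {β : ℝ}
    (μr : ℝ → Measure ℝ) (hprob : ∀ r : ℝ, 0 < r → IsProbabilityMeasure (μr r))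
    (hlap : ∀ r : ℝ, 0 < r → ∀ l : ℝ, 0 < l →
      ∫ s, Real.exp (-l * s) ∂(μr r) = Real.exp (-r * l ^ β))
    (pbar : ℝ → ℝ → ℝ) (hpbar_nn : ∀ r t : ℝ, 0 ≤ pbar r t)
    (hpbar_cont : ∀ r : ℝ, 0 < r → Continuous (pbar r))
    (hdens : ∀ r : ℝ, 0 < r → ∀ A : Set ℝ, MeasurableSet A →
      μr r A = ∫⁻ t in A ∩ Ici 0, ENNReal.ofReal (pbar r t))
    {c t : ℝ} (hc : 0 < c) (ht : 0 < t) :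
    pbar (c ^ β) t = c⁻¹ * pbar 1 (t / c) := by
  have hcβ : 0 < c ^ β := Real.rpow_pos_of_pos hc _
  have := hprob 1 one_pos
  have := hprob _ hcβ
  have hmeas : Measurable fun s : ℝ => c * s := by fun_prop
  have hsupp : ∀ r : ℝ, 0 < r → μr r (Iio 0) = 0 := fun r hr => by
    rw [hdens r hr _ measurableSet_Iio,
      disjoint_iff_inter_eq_empty.1 (Iio_disjoint_Ici le_rfl), Measure.restrict_empty,
      lintegral_zero_measure]
  have hmap : μr (c ^ β) = (μr 1).map fun s => c * s := by
    have : IsProbabilityMeasure ((μr 1).map fun s => c * s) :=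
      Measure.isProbabilityMeasure_map hmeas.aemeasurable
    refine measure_eq_of_laplace_eq _ _ (hsupp _ hcβ) ?_ fun l hl => ?_
    · rw [Measure.map_apply hmeas measurableSet_Iio]
      convert hsupp 1 one_pos using 2
      ext s
      simp [hc]
    · rw [integral_map hmeas.aemeasurable (by fun_prop), hlap _ hcβ l hl]
      have := hlap 1 one_pos (l * c) (by positivity)
      rw [Real.mul_rpow hl.le hc.le] at this
      calc Real.exp (-c ^ β * l ^ β) = Real.exp (-1 * (l ^ β * c ^ β)) := by ring_nf
        _ = _ := by rw [← this]; congr 1; ext s; ring_nf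
  have hG : Continuous fun s : ℝ => c⁻¹ * pbar 1 (s / c) :=
    continuous_const.mul ((hpbar_cont 1 one_pos).comp (continuous_id.div_const c))
  have hae : (fun s => ENNReal.ofReal (pbar (c ^ β) s)) =ᵐ[volume.restrict (Ici 0)]
      fun s => ENNReal.ofReal (c⁻¹ * pbar 1 (s / c)) := by
    rw [← withDensity_eq_iff_of_sigmaFinite
      (hpbar_cont _ hcβ).measurable.ennreal_ofReal.aemeasurable
      hG.measurable.ennreal_ofReal.aemeasurable]
    ext A hA
    rw [withDensity_apply _ hA, withDensity_apply _ hA, Measure.restrict_restrict hA,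
      ← hdens _ hcβ A hA, hmap, Measure.map_apply hmeas hA, hdens 1 one_pos _ (hmeas hA)]
    have himg : (fun s : ℝ => c * s) '' ((fun s => c * s) ⁻¹' A ∩ Ici 0) = A ∩ Ici 0 := by
      ext s
      simp only [mem_image, mem_inter_iff, mem_preimage, mem_Ici]
      constructor
      · rintro ⟨u, ⟨hu, hu0⟩, rfl⟩
        exact ⟨hu, by positivity⟩
      · rintro ⟨hs, hs0⟩
        exact ⟨s / c, ⟨by rwa [mul_div_cancel₀ _ hc.ne'], by positivity⟩,
          mul_div_cancel₀ _ hc.ne'⟩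
    rw [← himg, lintegral_image_eq_lintegral_abs_deriv_mul ((hmeas hA).inter measurableSet_Ici)
      (f' := fun _ => c)
      (fun x _ => by simpa using ((hasDerivAt_id x).const_mul c).hasDerivWithinAt)
      ((mul_right_injective₀ hc.ne').injOn)]
    refine lintegral_congr fun s => ?_
    rw [← ENNReal.ofReal_mul (abs_nonneg _), abs_of_pos hc, mul_div_cancel_left₀ _ hc.ne',
      mul_inv_cancel_left₀ hc.ne']
  have hae' : pbar (c ^ β) =ᵐ[volume.restrict (Ioi 0)] fun s => c⁻¹ * pbar 1 (s / c) := by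
    filter_upwards [ae_restrict_of_ae_restrict_of_subset Ioi_subset_Ici_self hae] with s hs
    exact (ENNReal.ofReal_eq_ofReal_iff (hpbar_nn _ _)
      (mul_nonneg (inv_nonneg.2 hc.le) (hpbar_nn _ _))).1 hs
  exact Measure.eqOn_open_of_ae_eq hae' isOpen_Ioi (hpbar_cont _ hcβ).continuousOn
    hG.continuousOn ht

/-- The substitution `r = (t / s) ^ β` turns an integral against `pbar r t dr` into an expectation
with respect to the law of the subordinator at time `1`. -/
theorem lintegral_stable_density {β : ℝ} (hβ : 0 < β)
    (μr : ℝ → Measure ℝ) (hprob : ∀ r : ℝ, 0 < r → IsProbabilityMeasure (μr r))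
    (hlap : ∀ r : ℝ, 0 < r → ∀ l : ℝ, 0 < l →
      ∫ s, Real.exp (-l * s) ∂(μr r) = Real.exp (-r * l ^ β))
    (pbar : ℝ → ℝ → ℝ) (hpbar_nn : ∀ r t : ℝ, 0 ≤ pbar r t)
    (hpbar_cont : ∀ r : ℝ, 0 < r → Continuous (pbar r))
    (hdens : ∀ r : ℝ, 0 < r → ∀ A : Set ℝ, MeasurableSet A →
      μr r A = ∫⁻ t in A ∩ Ici 0, ENNReal.ofReal (pbar r t))
    (F : ℝ → ℝ) (hFm : Measurable F) {t : ℝ} (ht : 0 < t) :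
    ∫⁻ r in Ioi (0 : ℝ), ENNReal.ofReal (F r * pbar r t) =
      ∫⁻ w, ENNReal.ofReal (β * t ^ (β - 1) * w * F (t ^ β * w))
        ∂((μr 1).map fun s => s ^ (-β)) := by
  have himg : (fun s : ℝ => (t / s) ^ β) '' Ioi 0 = Ioi 0 := by
    ext r
    simp only [mem_image, mem_Ioi]
    constructor
    · rintro ⟨s, hs, rfl⟩
      positivity
    · intro hr
      refine ⟨t / r ^ β⁻¹, by positivity, ?_⟩
      rw [div_div_cancel₀ ht.ne', Real.rpow_inv_rpow hr.le hβ.ne']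
  have hpow : ∀ s : ℝ, 0 < s → (t / s) ^ β = t ^ β * s ^ (-β) := fun s hs => by
    rw [Real.div_rpow ht.le hs.le, Real.rpow_neg hs.le, div_eq_mul_inv]
  have hinj : InjOn (fun s : ℝ => (t / s) ^ β) (Ioi 0) := by
    intro a ha b hb hab
    have ha' : 0 < a := ha
    have hb' : 0 < b := hb
    have h1 := Real.rpow_left_injOn hβ.ne' (show t / a ∈ {x : ℝ | 0 ≤ x} by
      simp only [mem_ofPred_eq]; positivity) (show t / b ∈ {x : ℝ | 0 ≤ x} by
      simp only [mem_ofPred_eq]; positivity) hab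
    field_simp at h1
    exact h1.symm
  have hderiv : ∀ s ∈ Ioi (0 : ℝ), HasDerivWithinAt (fun s : ℝ => (t / s) ^ β)
      (t ^ β * (-β * s ^ (-β - 1))) (Ioi 0) s := by
    intro s hs
    have hs' : 0 < s := hs
    have h1 : HasDerivWithinAt (fun s : ℝ => t ^ β * s ^ (-β))
        (t ^ β * (-β * s ^ (-β - 1))) (Ioi 0) s :=
      ((Real.hasDerivAt_rpow_const (Or.inl hs'.ne')).const_mul _).hasDerivWithinAt
    exact h1.congr (fun x hx => hpow x hx) (hpow s hs')
  have hmeasW : Measurable fun s : ℝ => s ^ (-β) := by fun_prop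
  have hdensity : μr 1 =
      (volume.restrict (Ici 0)).withDensity fun s => ENNReal.ofReal (pbar 1 s) := by
    ext A hA
    rw [withDensity_apply _ hA, Measure.restrict_restrict hA, hdens 1 one_pos A hA]
  have hm : Measurable fun w : ℝ => ENNReal.ofReal (β * t ^ (β - 1) * w * F (t ^ β * w)) := by
    fun_prop
  rw [← himg, lintegral_image_eq_lintegral_abs_deriv_mul measurableSet_Ioi hderiv hinj,
    lintegral_map hm hmeasW, hdensity, lintegral_withDensity_eq_lintegral_mul _
      (hpbar_cont 1 one_pos).measurable.ennreal_ofReal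
      (g := fun s => ENNReal.ofReal (β * t ^ (β - 1) * s ^ (-β) * F (t ^ β * s ^ (-β))))
      (hm.comp hmeasW),
    ← setLIntegral_congr Ioi_ae_eq_Ici]
  refine setLIntegral_congr_fun measurableSet_Ioi fun s hs => ?_
  have hs' : 0 < s := hs
  simp only [Pi.mul_apply]
  rw [← ENNReal.ofReal_mul (abs_nonneg _), ← ENNReal.ofReal_mul (hpbar_nn _ _),
    stable_density_scaling μr hprob hlap pbar hpbar_nn hpbar_cont hdens (div_pos ht hs') ht,
    hpow s hs', div_div_cancel₀ ht.ne']
  congr 1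
  have h1 : |t ^ β * (-β * s ^ (-β - 1))| = β * (t ^ (β - 1) * t) * (s ^ (-β) / s) := by
    rw [abs_mul, abs_mul, abs_neg, abs_of_pos hβ, abs_of_pos (by positivity),
      abs_of_pos (by positivity), Real.rpow_sub_one hs'.ne', Real.rpow_sub_one ht.ne',
      div_mul_cancel₀ _ ht.ne']
    ring
  rw [h1]
  field_simp

/-- The basic constant `1 - e⁻¹` appearing in the elementary Tauberian estimates. -/
theorem one_sub_exp_neg_one_pos : 0 < 1 - Real.exp (-1) := by
  have : Real.exp (-1) < 1 := Real.exp_lt_one_iff.2 (by norm_num)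
  linarith

/-- Concavity of `1 - e^{-x}` on `[0, 1]`. -/
theorem mul_le_one_sub_exp_neg {x : ℝ} (h0 : 0 ≤ x) (h1 : x ≤ 1) :
    (1 - Real.exp (-1)) * x ≤ 1 - Real.exp (-x) := by
  have h := convexOn_exp.2 (mem_univ (0 : ℝ)) (mem_univ (-1 : ℝ)) (sub_nonneg.2 h1) h0
    (by ring)
  simp only [smul_eq_mul, mul_zero, zero_add, Real.exp_zero, mul_one, mul_neg] at h
  linarith

theorem ae_pos_of_measure_Iic_zero {M : Measure ℝ} (h0 : M (Iic 0) = 0) : ∀ᵐ w ∂M, 0 < w := by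
  rw [ae_iff]
  simpa [Iic] using h0

section InverseStable

variable {β : ℝ} {M : Measure ℝ} [IsProbabilityMeasure M]

theorem integrable_exp_neg_rpow (h0 : M (Iic 0) = 0) {z : ℝ} (hz : 0 < z) :
    Integrable (fun w => Real.exp (-(z / w) ^ (1 / β))) M := by
  refine Integrable.of_bound
    (by fun_prop : Measurable fun w : ℝ => Real.exp (-(z / w) ^ (1 / β))).aestronglyMeasurable 1 ?_
  filter_upwards [ae_pos_of_measure_Iic_zero h0] with w hw
  simp only [Real.norm_eq_abs, Real.abs_exp]
  exact Real.exp_le_one_iff.2 (neg_nonpos.2 (by positivity))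

theorem measureReal_Iic_le (hβ : 0 < β) (h0 : M (Iic 0) = 0)
    (hL : ∀ z : ℝ, 0 < z → ∫ w, Real.exp (-(z / w) ^ (1 / β)) ∂M = Real.exp (-z))
    {x : ℝ} (hx : 0 < x) :
    M.real (Iic x) ≤ (1 - Real.exp (-1))⁻¹ * x := by
  have hk := one_sub_exp_neg_one_pos
  have hi := integrable_exp_neg_rpow (β := β) h0 hx
  have h1 := mul_meas_ge_le_integral_of_nonneg (μ := M)
    (f := fun w => 1 - Real.exp (-(x / w) ^ (1 / β))) (by
      filter_upwards [ae_pos_of_measure_Iic_zero h0] with w hw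
      exact sub_nonneg.2 (Real.exp_le_one_iff.2 (neg_nonpos.2 (by positivity))))
    ((integrable_const 1).sub hi) (1 - Real.exp (-1))
  rw [integral_sub (integrable_const 1) hi, hL x hx] at h1
  have h2 : M.real (Iic x) ≤
      M.real {w | 1 - Real.exp (-1) ≤ 1 - Real.exp (-(x / w) ^ (1 / β))} := by
    refine ENNReal.toReal_mono (measure_ne_top _ _) (measure_mono_ae ?_)
    filter_upwards [ae_pos_of_measure_Iic_zero h0] with w hw hwx
    refine sub_le_sub_left (Real.exp_le_exp.2 (neg_le_neg ?_)) _
    exact Real.one_le_rpow ((one_le_div hw).2 hwx) (by positivity)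
  have h3 : 1 - x ≤ Real.exp (-x) := by have := Real.add_one_le_exp (-x); linarith
  simp only [integral_const, probReal_univ, smul_eq_mul, mul_one] at h1
  rw [inv_mul_eq_div, le_div_iff₀ hk]
  nlinarith [mul_le_mul_of_nonneg_left h2 hk.le]

theorem exists_le_measureReal_Iic (hβ : 0 < β ∧ β < 1) (h0 : M (Iic 0) = 0)
    (hL : ∀ z : ℝ, 0 < z → ∫ w, Real.exp (-(z / w) ^ (1 / β)) ∂M = Real.exp (-z)) :
    ∃ c : ℝ, 0 < c ∧ ∀ x : ℝ, 0 < x → x ≤ 1 → c * x ≤ M.real (Iic x) := by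
  obtain ⟨hβ0, hβ1⟩ := hβ
  set k := 1 - Real.exp (-1) with hkdef
  have hk : 0 < k := one_sub_exp_neg_one_pos
  have hk1 : k ≤ 1 := by have := Real.exp_pos (-1); linarith
  set e := 1 / β - 1 with hedef
  have he : 0 < e := by
    have : 1 < 1 / β := (one_lt_div hβ0).2 hβ1
    linarith
  -- `θ = η ^ β` where `η` is the dilation factor
  set θ := (k ^ 2 / 2) ^ (1 / e) with hθdef
  have hθ : 0 < θ := by positivity
  have hθ1 : θ ≤ 1 := Real.rpow_le_one (by positivity) (by nlinarith) (by positivity)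
  have hθe : θ ^ (1 / β) = θ * (k ^ 2 / 2) := by
    have : 1 / β = 1 + e := by rw [hedef]; ring
    rw [this, Real.rpow_add hθ, Real.rpow_one]
    congr 1
    rw [hθdef, ← Real.rpow_mul (by positivity), one_div_mul_cancel he.ne', Real.rpow_one]
  refine ⟨k * θ / 2, by positivity, fun x hx hx1 => ?_⟩
  have hi1 := integrable_exp_neg_rpow (β := β) h0 hx
  have hi2 := integrable_exp_neg_rpow (β := β) h0 (mul_pos hθ hx)
  have hpt : ∀ᵐ w ∂M, 1 - Real.exp (-(θ * x / w) ^ (1 / β)) ≤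
      k⁻¹ * θ ^ (1 / β) * (1 - Real.exp (-(x / w) ^ (1 / β))) + (Iic x).indicator 1 w := by
    filter_upwards [ae_pos_of_measure_Iic_zero h0] with w hw
    have hmul : (θ * x / w) ^ (1 / β) = θ ^ (1 / β) * (x / w) ^ (1 / β) := by
      rw [mul_div_assoc, Real.mul_rpow hθ.le (by positivity)]
    set y := (x / w) ^ (1 / β) with hy
    have hy0 : 0 ≤ y := by positivity
    have hθb : 0 ≤ θ ^ (1 / β) := by positivity
    rw [hmul]
    by_cases hwx : w ≤ x
    · rw [indicator_of_mem (show w ∈ Iic x from hwx)]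
      have h1 := Real.exp_pos (-(θ ^ (1 / β) * y))
      have h2 : 0 ≤ 1 - Real.exp (-y) :=
        sub_nonneg.2 (Real.exp_le_one_iff.2 (neg_nonpos.2 hy0))
      have h3 : 0 ≤ k⁻¹ * θ ^ (1 / β) * (1 - Real.exp (-y)) := by positivity
      simp only [Pi.one_apply]
      linarith
    · rw [indicator_of_notMem (show w ∉ Iic x from hwx), add_zero]
      have hy1 : y ≤ 1 := Real.rpow_le_one (by positivity)
        ((div_le_one hw).2 (not_le.1 hwx).le) (by positivity)
      have h1 := mul_le_one_sub_exp_neg hy0 hy1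
      have h2 := Real.add_one_le_exp (-(θ ^ (1 / β) * y))
      calc 1 - Real.exp (-(θ ^ (1 / β) * y)) ≤ θ ^ (1 / β) * y := by linarith
        _ = k⁻¹ * θ ^ (1 / β) * (k * y) := by field_simp
        _ ≤ _ := by gcongr
  have hind : Integrable ((Iic x).indicator (1 : ℝ → ℝ)) M :=
    (integrable_const (1 : ℝ)).indicator measurableSet_Iic
  have hsub : Integrable (fun w => 1 - Real.exp (-(x / w) ^ (1 / β))) M :=
    (integrable_const 1).sub hi1
  have h1 := integral_mono_ae ((integrable_const 1).sub hi2)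
    ((hsub.const_mul (k⁻¹ * θ ^ (1 / β))).add hind) hpt
  simp only [Pi.add_apply] at h1
  rw [integral_add (hsub.const_mul _) hind, integral_const_mul, integral_indicator_one
    measurableSet_Iic] at h1
  simp only [Pi.sub_apply] at h1
  rw [integral_sub (integrable_const 1) hi1, integral_sub (integrable_const 1) hi2, hL x hx,
    hL _ (mul_pos hθ hx)] at h1
  simp only [integral_const, probReal_univ, smul_eq_mul, mul_one] at h1
  have h2 : 1 - x ≤ Real.exp (-x) := by have := Real.add_one_le_exp (-x); linarith
  have h3 : k * (θ * x) ≤ 1 - Real.exp (-(θ * x)) :=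
    mul_le_one_sub_exp_neg (by positivity) (by nlinarith)
  have h4 : k⁻¹ * θ ^ (1 / β) * (1 - Real.exp (-x)) ≤ k * θ / 2 * x := by
    calc k⁻¹ * θ ^ (1 / β) * (1 - Real.exp (-x)) ≤ k⁻¹ * θ ^ (1 / β) * x := by
          gcongr; linarith
      _ = k * θ / 2 * x := by rw [hθe]; field_simp
  linarith

theorem exists_le_measureReal_Ioc (hβ : 0 < β ∧ β < 1) (h0 : M (Iic 0) = 0)
    (hL : ∀ z : ℝ, 0 < z → ∫ w, Real.exp (-(z / w) ^ (1 / β)) ∂M = Real.exp (-z)) :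
    ∃ c κ : ℝ, 0 < c ∧ 0 < κ ∧ κ < 1 ∧
      ∀ x : ℝ, 0 < x → x ≤ 1 → c * x ≤ M.real (Ioc (κ * x) x) := by
  obtain ⟨c, hc, hlow⟩ := exists_le_measureReal_Iic hβ h0 hL
  have hk := one_sub_exp_neg_one_pos
  set k := 1 - Real.exp (-1)
  refine ⟨c / 2, min (1 / 2) (k * c / 2), by positivity, by positivity,
    (min_le_left _ _).trans_lt (by norm_num), fun x hx hx1 => ?_⟩
  set κ := min (1 / 2) (k * c / 2) with hκdef
  have hκ : 0 < κ := by positivity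
  have h1 := hlow x hx hx1
  have h2 := measureReal_Iic_le hβ.1 h0 hL (mul_pos hκ hx)
  have h3 : κ * x ≤ x := by
    have : κ ≤ 1 / 2 := min_le_left _ _
    nlinarith
  have h4 : M.real (Iic x) ≤ M.real (Iic (κ * x)) + M.real (Ioc (κ * x) x) := by
    rw [← Iic_union_Ioc_eq_Iic h3]
    exact measureReal_union_le _ _
  have h5 : k⁻¹ * (κ * x) ≤ c / 2 * x := by
    have : κ ≤ k * c / 2 := min_le_right _ _
    calc k⁻¹ * (κ * x) ≤ k⁻¹ * (k * c / 2 * x) := by gcongr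
      _ = c / 2 * x := by field_simp
  linarith

theorem div_rpow_one_sub_rpow (hβ : 0 < β) {θ V : ℝ} (hθ : 0 < θ) (hV : 0 < V) :
    (θ * V / V ^ (1 - β)) ^ (1 / β) = θ ^ (1 / β) * V := by
  have : θ * V / V ^ (1 - β) = θ * V ^ β := by
    rw [mul_div_assoc]
    congr 1
    nth_rewrite 1 [← Real.rpow_one V]
    rw [← Real.rpow_sub hV]
    congr 1; ring
  rw [this, Real.mul_rpow hθ.le (by positivity), ← Real.rpow_mul hV.le,
    mul_one_div_cancel hβ.ne', Real.rpow_one]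

theorem exists_measureReal_Ici_le (hβ : 0 < β ∧ β < 1) (h0 : M (Iic 0) = 0)
    (hL : ∀ z : ℝ, 0 < z → ∫ w, Real.exp (-(z / w) ^ (1 / β)) ∂M = Real.exp (-z)) :
    ∃ η : ℝ, 0 < η ∧ ∀ V : ℝ, 0 < V → M.real (Ici (V ^ (1 - β))) ≤ Real.exp (-(η * V)) := by
  obtain ⟨hβ0, hβ1⟩ := hβ
  set e := 1 / β - 1 with hedef
  have he : 0 < e := by
    have : 1 < 1 / β := (one_lt_div hβ0).2 hβ1
    linarith
  set θ : ℝ := (1 / 2) ^ (1 / e) with hθdef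
  have hθ : 0 < θ := by positivity
  have hθe : θ ^ (1 / β) = θ * (1 / 2) := by
    have : 1 / β = 1 + e := by rw [hedef]; ring
    rw [this, Real.rpow_add hθ, Real.rpow_one]
    congr 1
    rw [hθdef, ← Real.rpow_mul (by positivity), one_div_mul_cancel he.ne', Real.rpow_one]
  refine ⟨θ / 2, by positivity, fun V hV => ?_⟩
  have hVβ : 0 < V ^ (1 - β) := by positivity
  have h1 := mul_meas_ge_le_integral_of_nonneg (μ := M)
    (f := fun w => Real.exp (-(θ * V / w) ^ (1 / β))) (ae_of_all _ fun w => (Real.exp_pos _).le)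
    (integrable_exp_neg_rpow h0 (mul_pos hθ hV)) (Real.exp (-(θ ^ (1 / β) * V)))
  rw [hL _ (mul_pos hθ hV)] at h1
  have h2 : M.real (Ici (V ^ (1 - β))) ≤
      M.real {w | Real.exp (-(θ ^ (1 / β) * V)) ≤ Real.exp (-(θ * V / w) ^ (1 / β))} := by
    refine measureReal_mono (fun w hw => ?_)
    have hw' : V ^ (1 - β) ≤ w := hw
    refine Real.exp_le_exp.2 (neg_le_neg ?_)
    rw [← div_rpow_one_sub_rpow hβ0 hθ hV]
    have : 0 < w := hVβ.trans_le hw'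
    gcongr
  have h3 : Real.exp (-(θ / 2 * V)) * Real.exp (-(θ ^ (1 / β) * V)) = Real.exp (-(θ * V)) := by
    rw [← Real.exp_add, hθe]; ring_nf
  have h4 := Real.exp_pos (-(θ ^ (1 / β) * V))
  nlinarith [mul_le_mul_of_nonneg_left h2 h4.le]

theorem exists_le_measureReal_Ici (hβ : 0 < β ∧ β < 1) (h0 : M (Iic 0) = 0)
    (hL : ∀ z : ℝ, 0 < z → ∫ w, Real.exp (-(z / w) ^ (1 / β)) ∂M = Real.exp (-z)) :
    ∃ θ : ℝ, 0 < θ ∧ ∀ V : ℝ, 1 ≤ V →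
      (1 - Real.exp (-1)) * Real.exp (-(θ * V)) ≤ M.real (Ici (V ^ (1 - β))) := by
  obtain ⟨hβ0, hβ1⟩ := hβ
  set e := 1 / β - 1 with hedef
  have he : 0 < e := by
    have : 1 < 1 / β := (one_lt_div hβ0).2 hβ1
    linarith
  set θ : ℝ := 2 ^ (1 / e) with hθdef
  have hθ : 0 < θ := by positivity
  have hθ1 : 1 ≤ θ := Real.one_le_rpow (by norm_num) (by positivity)
  have hθe : θ ^ (1 / β) = θ * 2 := by
    have : 1 / β = 1 + e := by rw [hedef]; ring
    rw [this, Real.rpow_add hθ, Real.rpow_one]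
    congr 1
    rw [hθdef, ← Real.rpow_mul (by positivity), one_div_mul_cancel he.ne', Real.rpow_one]
  refine ⟨θ, hθ, fun V hV1 => ?_⟩
  have hV : 0 < V := by linarith
  have hVβ : 0 < V ^ (1 - β) := by positivity
  have hind : Integrable ((Ici (V ^ (1 - β))).indicator (1 : ℝ → ℝ)) M :=
    (integrable_const (1 : ℝ)).indicator measurableSet_Ici
  have hpt : ∀ᵐ w ∂M, Real.exp (-(θ * V / w) ^ (1 / β)) ≤
      Real.exp (-(θ ^ (1 / β) * V)) + (Ici (V ^ (1 - β))).indicator 1 w := by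
    filter_upwards [ae_pos_of_measure_Iic_zero h0] with w hw
    by_cases hwV : V ^ (1 - β) ≤ w
    · rw [indicator_of_mem (show w ∈ Ici _ from hwV)]
      have h1 := Real.exp_pos (-(θ ^ (1 / β) * V))
      have h2 : Real.exp (-(θ * V / w) ^ (1 / β)) ≤ 1 :=
        Real.exp_le_one_iff.2 (neg_nonpos.2 (by positivity))
      simp only [Pi.one_apply]
      linarith
    · rw [indicator_of_notMem (show w ∉ Ici _ from hwV), add_zero]
      refine Real.exp_le_exp.2 (neg_le_neg ?_)
      rw [← div_rpow_one_sub_rpow hβ0 hθ hV]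
      have := (not_le.1 hwV).le
      gcongr
  have h1 := integral_mono_ae (integrable_exp_neg_rpow h0 (mul_pos hθ hV))
    ((integrable_const _).add hind) hpt
  simp only [Pi.add_apply] at h1
  rw [integral_add (integrable_const _) hind, hL _ (mul_pos hθ hV),
    integral_indicator_one measurableSet_Ici] at h1
  simp only [integral_const, probReal_univ, smul_eq_mul, one_mul] at h1
  have h2 : Real.exp (-(θ ^ (1 / β) * V)) ≤ Real.exp (-(θ * V)) * Real.exp (-1) := by
    rw [← Real.exp_add, hθe]
    refine Real.exp_le_exp.2 ?_
    nlinarith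
  linarith

theorem exists_le_measureReal_Ico (hβ : 0 < β ∧ β < 1) (h0 : M (Iic 0) = 0)
    (hL : ∀ z : ℝ, 0 < z → ∫ w, Real.exp (-(z / w) ^ (1 / β)) ∂M = Real.exp (-z)) :
    ∃ c C K : ℝ, 0 < c ∧ 0 < C ∧ 1 ≤ K ∧ ∀ V : ℝ, 1 ≤ V →
      c * Real.exp (-(C * V)) ≤ M.real (Ico (V ^ (1 - β)) ((K * V) ^ (1 - β))) := by
  obtain ⟨η, hη, hup⟩ := exists_measureReal_Ici_le hβ h0 hL
  obtain ⟨θ, hθ, hlow⟩ := exists_le_measureReal_Ici hβ h0 hL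
  have hk := one_sub_exp_neg_one_pos
  set k := 1 - Real.exp (-1) with hkdef
  set m := -Real.log (k / 2) with hmdef
  have hm : Real.exp (-m) = k / 2 := by rw [hmdef, neg_neg, Real.exp_log (by positivity)]
  have hm0 : 0 ≤ m := by
    rw [hmdef, neg_nonneg]
    refine Real.log_nonpos (by positivity) ?_
    have := Real.exp_pos (-1)
    linarith
  refine ⟨k / 2, θ, max 1 ((θ + m) / η), by positivity, hθ, le_max_left _ _, fun V hV1 => ?_⟩
  set K := max 1 ((θ + m) / η) with hKdef
  have hK1 : 1 ≤ K := le_max_left _ _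
  have hV : 0 < V := by linarith
  have h1 := hlow V hV1
  have h2 := hup (K * V) (by positivity)
  have h3 : M.real (Ici (V ^ (1 - β))) ≤ M.real (Ico (V ^ (1 - β)) ((K * V) ^ (1 - β))) +
      M.real (Ici ((K * V) ^ (1 - β))) := by
    refine (measureReal_mono ?_).trans (measureReal_union_le _ _)
    intro w hw
    rcases lt_or_ge w ((K * V) ^ (1 - β)) with h | h
    · exact Or.inl ⟨hw, h⟩
    · exact Or.inr h
  have h4 : Real.exp (-(η * (K * V))) ≤ k / 2 * Real.exp (-(θ * V)) := by
    rw [← hm, ← Real.exp_add]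
    refine Real.exp_le_exp.2 ?_
    have : θ + m ≤ K * η := (div_le_iff₀ hη).1 (le_max_right _ _)
    nlinarith [mul_le_mul_of_nonneg_right this hV.le]
  linarith

theorem exists_lintegral_exp_rpow_le (hβ : 0 < β ∧ β < 1) (h0 : M (Iic 0) = 0)
    (hL : ∀ z : ℝ, 0 < z → ∫ w, Real.exp (-(z / w) ^ (1 / β)) ∂M = Real.exp (-z)) :
    ∃ η C : ℝ, 0 < η ∧ 0 < C ∧
      ∫⁻ w, ENNReal.ofReal (Real.exp (η * w ^ (1 / (1 - β)))) ∂M ≤ ENNReal.ofReal C := by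
  obtain ⟨η, hη, hup⟩ := exists_measureReal_Ici_le hβ h0 hL
  have h1β : 0 < 1 - β := by linarith [hβ.2]
  have hsum : Summable fun n : ℕ =>
      Real.exp (η / 2 * (n + 1)) * Real.exp (-(η * n)) := by
    have h := (summable_geometric_of_lt_one (Real.exp_pos (-(η / 2))).le
      (Real.exp_lt_one_iff.2 (by linarith))).mul_left (Real.exp (η / 2))
    refine h.congr fun n => ?_
    rw [← Real.exp_nat_mul, ← Real.exp_add, ← Real.exp_add]
    ring_nf
  refine ⟨η / 2, ∑' n : ℕ, Real.exp (η / 2 * (n + 1)) * Real.exp (-(η * n)), by positivity,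
    hsum.tsum_pos (fun n => by positivity) 0 (by positivity), ?_⟩
  have hpt : ∀ᵐ w ∂M, ENNReal.ofReal (Real.exp (η / 2 * w ^ (1 / (1 - β)))) ≤
      ∑' n : ℕ, (Ici ((n : ℝ) ^ (1 - β))).indicator
        (fun _ => ENNReal.ofReal (Real.exp (η / 2 * (n + 1)))) w := by
    filter_upwards [ae_pos_of_measure_Iic_zero h0] with w hw
    refine le_trans ?_ (ENNReal.le_tsum ⌊w ^ (1 / (1 - β))⌋₊)
    have hle : (⌊w ^ (1 / (1 - β))⌋₊ : ℝ) ^ (1 - β) ≤ w := by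
      calc (⌊w ^ (1 / (1 - β))⌋₊ : ℝ) ^ (1 - β) ≤ (w ^ (1 / (1 - β))) ^ (1 - β) := by
            gcongr
            exact Nat.floor_le (by positivity)
        _ = w := by rw [← Real.rpow_mul hw.le, one_div_mul_cancel h1β.ne', Real.rpow_one]
    rw [indicator_of_mem (show w ∈ Ici _ from hle)]
    gcongr
    exact (Nat.lt_floor_add_one _).le
  refine (lintegral_mono_ae hpt).trans ?_
  rw [lintegral_tsum fun n => (measurable_const.indicator measurableSet_Ici).aemeasurable,
    ENNReal.ofReal_tsum_of_nonneg (fun n => by positivity) hsum]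
  refine ENNReal.tsum_le_tsum fun n => ?_
  rw [lintegral_indicator_const measurableSet_Ici, ENNReal.ofReal_mul (by positivity)]
  gcongr
  rw [← ofReal_measureReal]
  refine ENNReal.ofReal_le_ofReal ?_
  rcases Nat.eq_zero_or_pos n with rfl | hn
  · simp
  · exact hup n (by exact_mod_cast hn)

end InverseStable

/-- The integral `E[W^{1-δ} exp(-a (R/W)^γ)]` to which the time-changed kernel reduces. -/
noncomputable def kernelMoment (M : Measure ℝ) (δ γ a R : ℝ) : ℝ≥0∞ :=
  ∫⁻ w, ENNReal.ofReal (w ^ (1 - δ) * Real.exp (-(a * (R / w) ^ γ))) ∂M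

/-- The dimensionless near-diagonal profile. -/
noncomputable def nearProfile (δ R : ℝ) : ℝ :=
  if δ < 2 then 1 else if δ = 2 then Real.log (2 / R) else R ^ (2 - δ)

theorem exists_rpow_le_mul_exp {m c : ℝ} (hm : 0 ≤ m) (hc : 0 < c) :
    ∃ C : ℝ, 1 ≤ C ∧ ∀ y : ℝ, 0 ≤ y → y ^ m ≤ C * Real.exp (c * y) := by
  refine ⟨max 1 ((m / c) ^ m), le_max_left _ _, fun y hy => ?_⟩
  have h := ProbabilityTheory.rpow_abs_le_mul_max_exp_of_pos y hm hc
  rw [abs_of_nonneg hy, max_eq_left (Real.exp_le_exp.2 (by nlinarith))] at h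
  exact h.trans (by gcongr; exact le_max_right _ _)

theorem log_two_le_nearProfile {δ R : ℝ} (hR : 0 < R) (hR1 : R ≤ 1) :
    Real.log 2 ≤ nearProfile δ R := by
  have hlog : Real.log 2 ≤ 1 := by linarith [Real.log_two_lt_d9]
  unfold nearProfile
  split_ifs with h1 h2
  · exact hlog
  · exact Real.log_le_log two_pos ((le_div_iff₀ hR).2 (by linarith))
  · exact hlog.trans (Real.one_le_rpow_of_pos_of_le_one_of_nonpos hR hR1
      (by linarith [not_lt.1 h1]))

theorem exists_lintegral_rpow_le_nearProfile (δ : ℝ) :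
    ∃ C : ℝ, 0 < C ∧ ∀ R : ℝ, 0 < R → R ≤ 1 →
      ∫⁻ x in Ioc R 2, ENNReal.ofReal (x ^ (1 - δ)) ≤
        ENNReal.ofReal (C * nearProfile δ R) := by
  have key : ∀ R : ℝ, 0 < R → R ≤ 1 → ∫⁻ x in Ioc R 2, ENNReal.ofReal (x ^ (1 - δ)) =
      ENNReal.ofReal (∫ x in R..2, x ^ (1 - δ)) := by
    intro R hR hR1
    have h0 : (0 : ℝ) ∉ uIcc R 2 := by
      rw [uIcc_of_le (by linarith)]
      exact fun h => absurd h.1 (not_le.2 hR)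
    rw [intervalIntegral.integral_of_le (by linarith), ofReal_integral_eq_lintegral_ofReal]
    · exact (intervalIntegral.intervalIntegrable_rpow (Or.inr h0)).1
    · filter_upwards [ae_restrict_mem measurableSet_Ioc] with x hx
      have : 0 < x := hR.trans hx.1
      positivity
  rcases lt_trichotomy δ 2 with hδ | hδ | hδ
  · refine ⟨2 ^ (2 - δ) / (2 - δ), div_pos (by positivity) (by linarith), fun R hR hR1 => ?_⟩
    rw [key R hR hR1, integral_rpow (Or.inl (by linarith)), nearProfile, if_pos hδ,
      show 1 - δ + 1 = 2 - δ by ring]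
    refine ENNReal.ofReal_le_ofReal ?_
    have : 0 < R ^ (2 - δ) := by positivity
    rw [mul_one]
    exact div_le_div_of_nonneg_right (by linarith) (by linarith)
  · refine ⟨1, one_pos, fun R hR hR1 => ?_⟩
    rw [key R hR hR1, nearProfile, if_neg (by linarith), if_pos hδ, one_mul, hδ]
    have : ∫ x in R..2, x ^ (1 - 2 : ℝ) = ∫ x in R..2, x⁻¹ := by
      refine intervalIntegral.integral_congr fun x _ => ?_
      norm_num [Real.rpow_neg_one]
    rw [this, integral_inv_of_pos hR two_pos]
  · refine ⟨1 / (δ - 2), div_pos one_pos (by linarith), fun R hR hR1 => ?_⟩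
    have h0 : (0 : ℝ) ∉ uIcc R 2 := by
      rw [uIcc_of_le (by linarith)]
      exact fun h => absurd h.1 (not_le.2 hR)
    rw [key R hR hR1, integral_rpow (Or.inr ⟨by linarith, h0⟩), nearProfile,
      if_neg (by linarith), if_neg (by linarith), show 1 - δ + 1 = 2 - δ by ring]
    refine ENNReal.ofReal_le_ofReal ?_
    have h1 : (0 : ℝ) < 2 ^ (2 - δ) := by positivity
    have h2 : (2 ^ (2 - δ) - R ^ (2 - δ)) / (2 - δ) = (R ^ (2 - δ) - 2 ^ (2 - δ)) / (δ - 2) := by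
      rw [← neg_sub δ 2, div_neg, ← neg_div, neg_sub]
    rw [h2, one_div_mul_eq_div]
    exact div_le_div_of_nonneg_right (by linarith) (by linarith)

/-- Tonelli's theorem for a family of sets indexed by a real parameter. -/
theorem setLIntegral_mul_measure_eq (M : Measure ℝ) [SFinite M] (S : Set ℝ) {g : ℝ → ℝ≥0∞}
    (hg : Measurable g) {T : Set (ℝ × ℝ)} (hT : MeasurableSet T) :
    ∫⁻ x in S, g x * M {w | (w, x) ∈ T} =
      ∫⁻ w, (∫⁻ x in S, T.indicator (fun q => g q.2) (w, x)) ∂M := by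
  rw [lintegral_lintegral_swap]
  · refine lintegral_congr fun x => ?_
    exact (lintegral_indicator_const (measurable_prodMk_right hT) (g x)).symm
  · exact ((hg.comp measurable_snd).indicator hT).aemeasurable

theorem exists_rpow_mul_exp_le_max {δ γ a : ℝ} (hδ : 0 < δ) (hγ : 0 < γ) (ha : 0 < a) :
    ∃ C : ℝ, 1 ≤ C ∧ ∀ R w : ℝ, 0 < R → 0 < w →
      w ^ (1 - δ) * Real.exp (-(a * (R / w) ^ γ)) ≤ C * (max w R) ^ (1 - δ) := by
  obtain ⟨C, hC, hexp⟩ := exists_rpow_le_mul_exp (div_nonneg hδ.le hγ.le) ha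
  refine ⟨C, hC, fun R w hR hw => ?_⟩
  rcases le_total R w with h | h
  · rw [max_eq_left h]
    have h1 : Real.exp (-(a * (R / w) ^ γ)) ≤ 1 :=
      Real.exp_le_one_iff.2 (neg_nonpos.2 (by positivity))
    have h2 : 0 < w ^ (1 - δ) := by positivity
    nlinarith
  · rw [max_eq_right h]
    set y := R / w with hy
    have hy1 : 1 ≤ y := (one_le_div hw).2 h
    have hy0 : 0 < y := by linarith
    have hRw : w = R / y := by rw [hy, div_div_cancel₀ hR.ne']
    have h1 : y ^ (δ - 1) ≤ C * Real.exp (a * y ^ γ) := by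
      calc y ^ (δ - 1) ≤ y ^ δ := Real.rpow_le_rpow_of_exponent_le hy1 (by linarith)
        _ = (y ^ γ) ^ (δ / γ) := by rw [← Real.rpow_mul hy0.le, mul_div_cancel₀ _ hγ.ne']
        _ ≤ _ := hexp _ (by positivity)
    have h2 : w ^ (1 - δ) = R ^ (1 - δ) * y ^ (δ - 1) := by
      rw [hRw, Real.div_rpow hR.le hy0.le, ← neg_sub 1 δ, Real.rpow_neg hy0.le, div_eq_mul_inv]
    calc w ^ (1 - δ) * Real.exp (-(a * y ^ γ))
        ≤ R ^ (1 - δ) * (C * Real.exp (a * y ^ γ)) * Real.exp (-(a * y ^ γ)) := by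
          rw [h2]; gcongr
      _ = C * R ^ (1 - δ) := by
          rw [mul_assoc, mul_assoc, ← Real.exp_add, add_neg_cancel, Real.exp_zero]; ring

theorem ofReal_rpow_one_sub_le_lintegral {δ R w : ℝ} (hδ : 0 < δ) (hR : 0 < R) (hR1 : R ≤ 1)
    (hw1 : w ≤ 1) :
    ENNReal.ofReal ((max w R) ^ (1 - δ)) ≤ ENNReal.ofReal (2 ^ δ) *
      ∫⁻ x in Ioc R 2, {q : ℝ × ℝ | q.1 ≤ q.2}.indicator
        (fun q => ENNReal.ofReal (q.2 ^ (-δ))) (w, x) := by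
  set v := max w R with hv
  have hv0 : 0 < v := hR.trans_le (le_max_right _ _)
  have hv1 : v ≤ 1 := max_le hw1 hR1
  have hsub : Ioc v (2 * v) ⊆ Ioc R 2 := fun x hx =>
    ⟨(le_max_right w R).trans_lt hx.1, hx.2.trans (by linarith)⟩
  have h1 : ENNReal.ofReal ((2 * v) ^ (-δ)) * ENNReal.ofReal v ≤
      ∫⁻ x in Ioc R 2, {q : ℝ × ℝ | q.1 ≤ q.2}.indicator
        (fun q => ENNReal.ofReal (q.2 ^ (-δ))) (w, x) := by
    calc ENNReal.ofReal ((2 * v) ^ (-δ)) * ENNReal.ofReal v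
        = ∫⁻ x in Ioc v (2 * v), ENNReal.ofReal ((2 * v) ^ (-δ)) := by
          rw [setLIntegral_const, Real.volume_Ioc, two_mul, add_sub_cancel_right]
      _ ≤ ∫⁻ x in Ioc v (2 * v), {q : ℝ × ℝ | q.1 ≤ q.2}.indicator
            (fun q => ENNReal.ofReal (q.2 ^ (-δ))) (w, x) := by
          refine setLIntegral_mono' measurableSet_Ioc fun x hx => ?_
          have hwx : (w, x) ∈ {q : ℝ × ℝ | q.1 ≤ q.2} := ((le_max_left w R).trans_lt hx.1).le
          rw [indicator_of_mem hwx]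
          exact ENNReal.ofReal_le_ofReal
            (Real.rpow_le_rpow_of_nonpos (hv0.trans hx.1) hx.2 (by linarith))
      _ ≤ _ := lintegral_mono_set hsub
  refine le_trans (le_of_eq ?_) (mul_le_mul_right h1 _)
  rw [← ENNReal.ofReal_mul (by positivity), ← ENNReal.ofReal_mul (by positivity)]
  congr 1
  rw [Real.mul_rpow two_pos.le hv0.le, ← mul_assoc, ← mul_assoc, ← Real.rpow_add two_pos,
    add_neg_cancel, Real.rpow_zero, one_mul, sub_eq_add_neg, Real.rpow_add hv0, Real.rpow_one,
    mul_comm]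

theorem le_kernelMoment_of_le_on {M : Measure ℝ} {δ γ a R m : ℝ} {A : Set ℝ} (hA : MeasurableSet A)
    (h : ∀ w ∈ A, m ≤ w ^ (1 - δ) * Real.exp (-(a * (R / w) ^ γ))) :
    ENNReal.ofReal m * M A ≤ kernelMoment M δ γ a R := by
  rw [← setLIntegral_const]
  refine (setLIntegral_mono' hA fun w hw => ENNReal.ofReal_le_ofReal (h w hw)).trans ?_
  exact setLIntegral_le_lintegral _ _

section Bounds

variable {β δ γ a : ℝ} {M : Measure ℝ} [IsProbabilityMeasure M]

theorem exists_kernelMoment_near_upper (hβ : 0 < β ∧ β < 1) (hδ : 0 < δ) (hγ : 0 < γ)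
    (ha : 0 < a) (h0 : M (Iic 0) = 0)
    (hL : ∀ z : ℝ, 0 < z → ∫ w, Real.exp (-(z / w) ^ (1 / β)) ∂M = Real.exp (-z)) :
    ∃ C : ℝ, 0 < C ∧ ∀ R : ℝ, 0 < R → R ≤ 1 →
      kernelMoment M δ γ a R ≤ ENNReal.ofReal (C * nearProfile δ R) := by
  obtain ⟨η, Cη, hη, hCη, hmom⟩ := exists_lintegral_exp_rpow_le hβ h0 hL
  obtain ⟨C₁, hC₁, hmax⟩ := exists_rpow_mul_exp_le_max hδ hγ ha
  obtain ⟨C₂, hC₂, hprof⟩ := exists_lintegral_rpow_le_nearProfile δ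
  obtain ⟨C₃, hC₃, hexp⟩ := exists_rpow_le_mul_exp zero_le_one hη
  have hk := one_sub_exp_neg_one_pos
  set k := 1 - Real.exp (-1)
  have h1β : 0 < 1 - β := by linarith [hβ.2]
  have hlog := Real.log_pos one_lt_two
  refine ⟨C₁ * 2 ^ δ * (k⁻¹ * C₂) + C₃ * Cη / Real.log 2, by positivity, fun R hR hR1 => ?_⟩
  have hP := log_two_le_nearProfile (δ := δ) hR hR1
  have hP0 : 0 < nearProfile δ R := hlog.trans_le hP
  set T : Set (ℝ × ℝ) := {q | q.1 ≤ q.2} with hTdef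
  have hT : MeasurableSet T := measurableSet_le measurable_fst measurable_snd
  have hg : Measurable fun x : ℝ => ENNReal.ofReal (x ^ (-δ)) := by fun_prop
  have hinner : Measurable fun w : ℝ => ∫⁻ x in Ioc R 2,
      T.indicator (fun q => ENNReal.ofReal (q.2 ^ (-δ))) (w, x) :=
    ((hg.comp measurable_snd).indicator hT).lintegral_prod_right'
  have hpt : ∀ᵐ w ∂M, ENNReal.ofReal (w ^ (1 - δ) * Real.exp (-(a * (R / w) ^ γ))) ≤
      ENNReal.ofReal (C₁ * 2 ^ δ) * (∫⁻ x in Ioc R 2,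
        T.indicator (fun q => ENNReal.ofReal (q.2 ^ (-δ))) (w, x)) +
      ENNReal.ofReal C₃ * ENNReal.ofReal (Real.exp (η * w ^ (1 / (1 - β)))) := by
    filter_upwards [ae_pos_of_measure_Iic_zero h0] with w hw
    rcases le_total w 1 with hw1 | hw1
    · refine le_add_right ?_
      refine (ENNReal.ofReal_le_ofReal (hmax R w hR hw)).trans ?_
      rw [ENNReal.ofReal_mul (by positivity), ENNReal.ofReal_mul (by positivity), mul_assoc]
      gcongr
      exact ofReal_rpow_one_sub_le_lintegral hδ hR hR1 hw1
    · refine le_add_left ?_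
      rw [← ENNReal.ofReal_mul (by positivity)]
      refine ENNReal.ofReal_le_ofReal ?_
      have h1 : Real.exp (-(a * (R / w) ^ γ)) ≤ 1 :=
        Real.exp_le_one_iff.2 (neg_nonpos.2 (by positivity))
      have h2 : w ^ (1 - δ) ≤ w ^ (1 / (1 - β)) := by
        refine Real.rpow_le_rpow_of_exponent_le hw1 ?_
        have : 1 ≤ 1 / (1 - β) := (one_le_div h1β).2 (by linarith [hβ.1])
        linarith
      have h3 := hexp (w ^ (1 / (1 - β))) (by positivity)
      rw [Real.rpow_one] at h3
      have h4 : 0 < w ^ (1 - δ) := by positivity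
      nlinarith
  have hmain : ∫⁻ w, (∫⁻ x in Ioc R 2,
      T.indicator (fun q => ENNReal.ofReal (q.2 ^ (-δ))) (w, x)) ∂M ≤
      ENNReal.ofReal (k⁻¹ * C₂ * nearProfile δ R) := by
    rw [← setLIntegral_mul_measure_eq M (Ioc R 2) hg hT]
    calc ∫⁻ x in Ioc R 2, ENNReal.ofReal (x ^ (-δ)) * M {w | (w, x) ∈ T}
        ≤ ∫⁻ x in Ioc R 2, ENNReal.ofReal k⁻¹ * ENNReal.ofReal (x ^ (1 - δ)) := by
          refine setLIntegral_mono' measurableSet_Ioc fun x hx => ?_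
          have hx0 : 0 < x := hR.trans hx.1
          have h1 : M {w | (w, x) ∈ T} ≤ ENNReal.ofReal (k⁻¹ * x) := by
            have h2 := ENNReal.ofReal_le_ofReal (measureReal_Iic_le hβ.1 h0 hL hx0)
            rwa [ofReal_measureReal] at h2
          refine (mul_le_mul_right h1 _).trans (le_of_eq ?_)
          rw [← ENNReal.ofReal_mul (by positivity), ← ENNReal.ofReal_mul (by positivity),
            sub_eq_neg_add, Real.rpow_add hx0, Real.rpow_one]
          ring_nf
      _ = ENNReal.ofReal k⁻¹ * ∫⁻ x in Ioc R 2, ENNReal.ofReal (x ^ (1 - δ)) :=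
          lintegral_const_mul _ (by fun_prop)
      _ ≤ ENNReal.ofReal k⁻¹ * ENNReal.ofReal (C₂ * nearProfile δ R) := by
          gcongr
          exact hprof R hR hR1
      _ = _ := by rw [← ENNReal.ofReal_mul (by positivity), mul_assoc]
  unfold kernelMoment
  refine (lintegral_mono_ae hpt).trans ?_
  rw [lintegral_add_left (hinner.const_mul _), lintegral_const_mul _ hinner,
    lintegral_const_mul _ (by fun_prop)]
  refine (add_le_add (mul_le_mul_right hmain _) (mul_le_mul_right hmom _)).trans ?_
  rw [← ENNReal.ofReal_mul (by positivity), ← ENNReal.ofReal_mul (by positivity),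
    ← ENNReal.ofReal_add (by positivity) (by positivity)]
  refine ENNReal.ofReal_le_ofReal ?_
  have h5 : C₃ * Cη ≤ C₃ * Cη / Real.log 2 * nearProfile δ R := by
    rw [div_mul_eq_mul_div, le_div_iff₀ hlog]
    gcongr
  rw [add_mul]
  refine add_le_add (le_of_eq (by ring)) h5

theorem rpow_mul_exp_window_lower {κ R x w : ℝ} (hδ : 0 < δ) (hγ : 0 < γ) (ha : 0 < a)
    (hκ : 0 < κ) (hR : 0 < R) (hRx : R ≤ x) (hw : w ∈ Ioc (κ * x) x) :
    κ * Real.exp (-(a * (1 / κ) ^ γ)) * x ^ (1 - δ) ≤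
      w ^ (1 - δ) * Real.exp (-(a * (R / w) ^ γ)) := by
  have hx : 0 < x := hR.trans_le hRx
  have hw0 : 0 < w := (mul_pos hκ hx).trans hw.1
  have h1 : κ * x ^ (1 - δ) ≤ w ^ (1 - δ) := by
    have h2 : κ ≤ (w / x) ^ (1 - δ) := by
      calc κ ≤ w / x := (le_div_iff₀ hx).2 hw.1.le
        _ = (w / x) ^ (1 : ℝ) := (Real.rpow_one _).symm
        _ ≤ (w / x) ^ (1 - δ) := Real.rpow_le_rpow_of_exponent_ge (by positivity)
            ((div_le_one hx).2 hw.2) (by linarith)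
    rw [Real.div_rpow hw0.le hx.le, le_div_iff₀ (by positivity)] at h2
    exact h2
  have h3 : R / w ≤ 1 / κ := by
    rw [div_le_div_iff₀ hw0 hκ]
    nlinarith [hw.1]
  calc κ * Real.exp (-(a * (1 / κ) ^ γ)) * x ^ (1 - δ)
      = κ * x ^ (1 - δ) * Real.exp (-(a * (1 / κ) ^ γ)) := by ring
    _ ≤ _ := by gcongr

theorem exists_kernelMoment_log_lower (hβ : 0 < β ∧ β < 1) (hγ : 0 < γ) (ha : 0 < a)
    (h0 : M (Iic 0) = 0)
    (hL : ∀ z : ℝ, 0 < z → ∫ w, Real.exp (-(z / w) ^ (1 / β)) ∂M = Real.exp (-z)) :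
    ∃ c : ℝ, 0 < c ∧ ∀ R : ℝ, 0 < R → R ≤ 1 →
      ENNReal.ofReal (c * Real.log (2 / R)) ≤ kernelMoment M 2 γ a R := by
  obtain ⟨c, κ, hc, hκ, hκ1, hlow⟩ := exists_le_measureReal_Ioc hβ h0 hL
  set D := κ⁻¹ * Real.exp (a * (2 / κ) ^ γ) with hD
  have hD0 : 0 < D := by positivity
  refine ⟨D⁻¹ * c, by positivity, fun R hR hR1 => ?_⟩
  set T : Set (ℝ × ℝ) := {q | κ * q.2 < q.1 ∧ q.1 ≤ q.2} with hTdef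
  have hT : MeasurableSet T := (measurableSet_lt (by fun_prop) measurable_fst).inter
    (measurableSet_le measurable_fst measurable_snd)
  have hg : Measurable fun x : ℝ => ENNReal.ofReal (x ^ (-2 : ℝ)) := by fun_prop
  have hR2 : 0 < R / 2 := by positivity
  have hinner : ∀ᵐ w ∂M, ∫⁻ x in Ioc (R / 2) 1,
      T.indicator (fun q => ENNReal.ofReal (q.2 ^ (-2 : ℝ))) (w, x) ≤
      ENNReal.ofReal D *
        ENNReal.ofReal (w ^ (1 - 2 : ℝ) * Real.exp (-(a * (R / w) ^ γ))) := by
    filter_upwards [ae_pos_of_measure_Iic_zero h0] with w hw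
    rcases le_or_gt w (κ * (R / 2)) with hwR | hwR
    · refine le_trans (le_of_eq ?_) (zero_le)
      refine setLIntegral_eq_zero measurableSet_Ioc fun x hx => ?_
      refine indicator_of_notMem (fun h => ?_) _
      have h1 : κ * x < w := h.1
      nlinarith [hx.1]
    · calc ∫⁻ x in Ioc (R / 2) 1, T.indicator (fun q => ENNReal.ofReal (q.2 ^ (-2 : ℝ))) (w, x)
          ≤ ∫⁻ x, (Icc w (w / κ)).indicator (fun _ => ENNReal.ofReal (w ^ (-2 : ℝ))) x := by
            refine (setLIntegral_le_lintegral _ _).trans (lintegral_mono fun x => ?_)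
            by_cases hx : (w, x) ∈ T
            · have hx' : x ∈ Icc w (w / κ) :=
                ⟨hx.2, (le_div_iff₀ hκ).2 (by have : κ * x < w := hx.1; linarith)⟩
              rw [indicator_of_mem hx, indicator_of_mem hx']
              exact ENNReal.ofReal_le_ofReal
                (Real.rpow_le_rpow_of_nonpos hw hx'.1 (by norm_num))
            · rw [indicator_of_notMem hx]
              exact zero_le
        _ = ENNReal.ofReal (w ^ (-2 : ℝ) * (w / κ - w)) := by
            rw [lintegral_indicator_const measurableSet_Icc, Real.volume_Icc,
              ← ENNReal.ofReal_mul (by positivity)]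
        _ ≤ _ := by
            rw [← ENNReal.ofReal_mul hD0.le]
            refine ENNReal.ofReal_le_ofReal ?_
            have h1 : R / w ≤ 2 / κ := by
              rw [div_le_div_iff₀ hw hκ]
              linarith
            have h2 : 1 ≤ Real.exp (a * (2 / κ) ^ γ) * Real.exp (-(a * (R / w) ^ γ)) := by
              rw [← Real.exp_add]
              refine Real.one_le_exp ?_
              have : (R / w) ^ γ ≤ (2 / κ) ^ γ := by gcongr
              nlinarith
            have h3 : w ^ (1 - 2 : ℝ) = w ^ (-2 : ℝ) * w := by
              rw [← Real.rpow_add_one hw.ne']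
              norm_num
            have h4 : 0 < w ^ (-2 : ℝ) := by positivity
            calc w ^ (-2 : ℝ) * (w / κ - w) ≤ w ^ (-2 : ℝ) * (w / κ) * 1 := by
                  rw [mul_one]; gcongr; linarith
              _ ≤ w ^ (-2 : ℝ) * (w / κ) *
                  (Real.exp (a * (2 / κ) ^ γ) * Real.exp (-(a * (R / w) ^ γ))) := by gcongr
              _ = _ := by rw [h3, hD, div_eq_mul_inv]; ring
  have hmain : ENNReal.ofReal (c * Real.log (2 / R)) ≤
      ENNReal.ofReal D * kernelMoment M 2 γ a R := by
    unfold kernelMoment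
    rw [← lintegral_const_mul _ (by fun_prop)]
    refine le_trans ?_ (lintegral_mono_ae hinner)
    rw [← setLIntegral_mul_measure_eq M (Ioc (R / 2) 1) hg hT]
    have hnn : ∀ᵐ x ∂volume.restrict (Ioc (R / 2) 1), 0 ≤ c * x⁻¹ := by
      filter_upwards [ae_restrict_mem measurableSet_Ioc] with x hx
      have : 0 < x := hR2.trans hx.1
      positivity
    have hii : Integrable (fun x : ℝ => c * x⁻¹) (volume.restrict (Ioc (R / 2) 1)) := by
      have h1 : IntervalIntegrable (fun x : ℝ => x⁻¹) volume (R / 2) 1 := by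
        refine intervalIntegral.intervalIntegrable_inv (fun x hx => ?_) continuousOn_id
        rw [uIcc_of_le (by linarith)] at hx
        exact (hR2.trans_le hx.1).ne'
      exact h1.1.const_mul c
    have hlogint : c * Real.log (2 / R) = ∫ x in Ioc (R / 2) 1, c * x⁻¹ := by
      rw [integral_const_mul, ← intervalIntegral.integral_of_le (by linarith),
        integral_inv_of_pos hR2 one_pos, one_div_div]
    rw [hlogint, ofReal_integral_eq_lintegral_ofReal hii hnn]
    refine setLIntegral_mono' measurableSet_Ioc fun x hx => ?_
    have hx0 : 0 < x := hR2.trans hx.1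
    have h1 : ENNReal.ofReal (c * x) ≤ M {w | (w, x) ∈ T} := by
      have h2 := ENNReal.ofReal_le_ofReal (hlow x hx0 hx.2)
      rwa [ofReal_measureReal] at h2
    refine le_trans (le_of_eq ?_) (mul_le_mul_right h1 _)
    rw [← ENNReal.ofReal_mul (by positivity)]
    congr 1
    have : x ^ (-2 : ℝ) = (x ^ 2)⁻¹ := by
      rw [Real.rpow_neg hx0.le]
      norm_num
    rw [this]
    field_simp
  rw [mul_assoc, ENNReal.ofReal_mul (by positivity)]
  calc ENNReal.ofReal D⁻¹ * ENNReal.ofReal (c * Real.log (2 / R))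
      ≤ ENNReal.ofReal D⁻¹ * (ENNReal.ofReal D * kernelMoment M 2 γ a R) := by gcongr
    _ = kernelMoment M 2 γ a R := by
        rw [← mul_assoc, ← ENNReal.ofReal_mul (by positivity), inv_mul_cancel₀ hD0.ne',
          ENNReal.ofReal_one, one_mul]

theorem exists_kernelMoment_near_lower (hβ : 0 < β ∧ β < 1) (hδ : 0 < δ) (hγ : 0 < γ)
    (ha : 0 < a) (h0 : M (Iic 0) = 0)
    (hL : ∀ z : ℝ, 0 < z → ∫ w, Real.exp (-(z / w) ^ (1 / β)) ∂M = Real.exp (-z)) :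
    ∃ c : ℝ, 0 < c ∧ ∀ R : ℝ, 0 < R → R ≤ 1 →
      ENNReal.ofReal (c * nearProfile δ R) ≤ kernelMoment M δ γ a R := by
  rcases eq_or_ne δ 2 with rfl | hδ2
  · obtain ⟨c, hc, h⟩ := exists_kernelMoment_log_lower hβ hγ ha h0 hL
    refine ⟨c, hc, fun R hR hR1 => ?_⟩
    simpa [nearProfile] using h R hR hR1
  obtain ⟨c, κ, hc, hκ, hκ1, hlow⟩ := exists_le_measureReal_Ioc hβ h0 hL
  refine ⟨κ * Real.exp (-(a * (1 / κ) ^ γ)) * c, by positivity, fun R hR hR1 => ?_⟩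
  have key : ∀ x : ℝ, R ≤ x → x ≤ 1 →
      ENNReal.ofReal (κ * Real.exp (-(a * (1 / κ) ^ γ)) * c * x ^ (2 - δ)) ≤
        kernelMoment M δ γ a R := by
    intro x hRx hx1
    have hx : 0 < x := hR.trans_le hRx
    refine le_trans ?_ (le_kernelMoment_of_le_on measurableSet_Ioc fun w hw =>
      rpow_mul_exp_window_lower hδ hγ ha hκ hR hRx hw)
    have h1 := ENNReal.ofReal_le_ofReal (hlow x hx hx1)
    rw [ofReal_measureReal] at h1
    refine le_trans (le_of_eq ?_) (mul_le_mul_right h1 _)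
    rw [← ENNReal.ofReal_mul (by positivity), show 2 - δ = (1 - δ) + 1 by ring,
      Real.rpow_add_one hx.ne']
    ring_nf
  unfold nearProfile
  split_ifs with h1
  · simpa using key 1 hR1 le_rfl
  · exact key R le_rfl hR1

end Bounds

theorem le_rpow_or_le_rpow {α β R w : ℝ} (hα : 1 < α) (hβ : β < 1) (hR : 0 < R) (hw : 0 < w) :
    R ^ (1 / (α - β)) ≤ (R / w) ^ (1 / (α - 1)) ∨
      R ^ (1 / (α - β)) ≤ w ^ (1 / (1 - β)) := by
  have h1 : 0 < α - 1 := by linarith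
  have h2 : 0 < 1 - β := by linarith
  have h3 : 0 < α - β := by linarith
  set V := R ^ (1 / (α - β)) with hV
  have hV0 : 0 < V := by positivity
  rcases le_total w (V ^ (1 - β)) with h | h
  · left
    rw [one_div, Real.le_rpow_inv_iff_of_pos hV0.le (by positivity) h1, le_div_iff₀ hw]
    calc V ^ (α - 1) * w ≤ V ^ (α - 1) * V ^ (1 - β) := by gcongr
      _ = V ^ (α - β) := by rw [← Real.rpow_add hV0]; ring_nf
      _ = R := by rw [hV, ← Real.rpow_mul hR.le, one_div_mul_cancel h3.ne', Real.rpow_one]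
  · right
    rwa [one_div, Real.le_rpow_inv_iff_of_pos hV0.le hw.le h2]

theorem exists_rpow_one_sub_mul_exp_le {δ γ a η b : ℝ} (hδ : 0 < δ) (hγ : 0 < γ) (ha : 0 < a)
    (hη : 0 < η) (hb : 1 ≤ b) :
    ∃ C : ℝ, 1 ≤ C ∧ ∀ R w : ℝ, 1 ≤ R → 0 < w →
      w ^ (1 - δ) ≤ C * Real.exp (a * (R / w) ^ γ + η * w ^ b) := by
  obtain ⟨C₁, hC₁, h₁⟩ := exists_rpow_le_mul_exp zero_le_one hη
  obtain ⟨C₂, hC₂, h₂⟩ := exists_rpow_le_mul_exp (div_nonneg hδ.le hγ.le) ha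
  refine ⟨max C₁ C₂, le_max_of_le_left hC₁, fun R w hR hw => ?_⟩
  have hR0 : 0 < R := by linarith
  have hG : 0 ≤ a * (R / w) ^ γ := by positivity
  have hU : 0 ≤ η * w ^ b := by positivity
  rcases le_total 1 w with h | h
  · calc w ^ (1 - δ) ≤ w ^ b := Real.rpow_le_rpow_of_exponent_le h (by linarith)
      _ ≤ C₁ * Real.exp (η * w ^ b) := by simpa using h₁ (w ^ b) (by positivity)
      _ ≤ _ := by
        gcongr
        · exact le_max_left _ _
        · linarith
  · calc w ^ (1 - δ) ≤ w ^ (-δ) := Real.rpow_le_rpow_of_exponent_ge hw h (by linarith)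
      _ = ((1 / w) ^ γ) ^ (δ / γ) := by
        rw [← Real.rpow_mul (by positivity), mul_div_cancel₀ _ hγ.ne', one_div,
          Real.inv_rpow hw.le, Real.rpow_neg hw.le]
      _ ≤ C₂ * Real.exp (a * (1 / w) ^ γ) := h₂ _ (by positivity)
      _ ≤ _ := by
        have : (1 / w) ^ γ ≤ (R / w) ^ γ := by gcongr
        gcongr
        · exact le_max_right _ _
        · nlinarith

section FarBounds

variable {α β δ a : ℝ} {M : Measure ℝ} [IsProbabilityMeasure M]

theorem exists_kernelMoment_far_upper (hα : 1 < α) (hβ : 0 < β ∧ β < 1) (hδ : 0 < δ)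
    (ha : 0 < a) (h0 : M (Iic 0) = 0)
    (hL : ∀ z : ℝ, 0 < z → ∫ w, Real.exp (-(z / w) ^ (1 / β)) ∂M = Real.exp (-z)) :
    ∃ C c : ℝ, 0 < C ∧ 0 < c ∧ ∀ R : ℝ, 1 ≤ R →
      kernelMoment M δ (1 / (α - 1)) a R ≤
        ENNReal.ofReal (C * Real.exp (-(c * R ^ (1 / (α - β))))) := by
  obtain ⟨η, Cη, hη, hCη, hmom⟩ := exists_lintegral_exp_rpow_le hβ h0 hL
  have h1β : 0 < 1 - β := by linarith [hβ.2]
  have hγ : 0 < 1 / (α - 1) := div_pos one_pos (by linarith)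
  obtain ⟨C, hC, hpow⟩ := exists_rpow_one_sub_mul_exp_le (b := 1 / (1 - β)) hδ hγ
    (half_pos ha) (half_pos hη) ((one_le_div h1β).2 (by linarith [hβ.1]))
  refine ⟨C * Cη, min (a / 2) (η / 2), by positivity, by positivity, fun R hR => ?_⟩
  have hR0 : 0 < R := by linarith
  set γ := 1 / (α - 1)
  set c := min (a / 2) (η / 2)
  set V := R ^ (1 / (α - β)) with hV
  have hV0 : 0 < V := by positivity
  have hpt : ∀ᵐ w ∂M, ENNReal.ofReal (w ^ (1 - δ) * Real.exp (-(a * (R / w) ^ γ))) ≤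
      ENNReal.ofReal (C * Real.exp (-(c * V))) *
        ENNReal.ofReal (Real.exp (η * w ^ (1 / (1 - β)))) := by
    filter_upwards [ae_pos_of_measure_Iic_zero h0] with w hw
    rw [← ENNReal.ofReal_mul (by positivity)]
    refine ENNReal.ofReal_le_ofReal ?_
    have hG : 0 ≤ (R / w) ^ γ := by positivity
    have hU : 0 ≤ w ^ (1 / (1 - β)) := by positivity
    have hcV : c * V ≤ a / 2 * (R / w) ^ γ + η / 2 * w ^ (1 / (1 - β)) := by
      rcases le_rpow_or_le_rpow hα hβ.2 hR0 hw with h | h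
      · have : c * V ≤ a / 2 * (R / w) ^ γ := mul_le_mul (min_le_left _ _) h hV0.le (by positivity)
        have : 0 ≤ η / 2 * w ^ (1 / (1 - β)) := by positivity
        linarith
      · have : c * V ≤ η / 2 * w ^ (1 / (1 - β)) :=
          mul_le_mul (min_le_right _ _) h hV0.le (by positivity)
        have : 0 ≤ a / 2 * (R / w) ^ γ := by positivity
        linarith
    calc w ^ (1 - δ) * Real.exp (-(a * (R / w) ^ γ))
        ≤ C * Real.exp (a / 2 * (R / w) ^ γ + η / 2 * w ^ (1 / (1 - β))) *
            Real.exp (-(a * (R / w) ^ γ)) := by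
          gcongr
          exact hpow R w hR hw
      _ = C * Real.exp (a / 2 * (R / w) ^ γ + η / 2 * w ^ (1 / (1 - β)) - a * (R / w) ^ γ) := by
          rw [mul_assoc, ← Real.exp_add, ← sub_eq_add_neg]
      _ ≤ C * Real.exp (-(c * V) + η * w ^ (1 / (1 - β))) := by
          gcongr
          linarith
      _ = _ := by rw [Real.exp_add, mul_assoc]
  unfold kernelMoment
  refine (lintegral_mono_ae hpt).trans ?_
  rw [lintegral_const_mul _ (by fun_prop)]
  refine (mul_le_mul_right hmom _).trans (le_of_eq ?_)
  rw [← ENNReal.ofReal_mul (by positivity)]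
  ring_nf

theorem exists_kernelMoment_far_lower (hα : 1 < α) (hβ : 0 < β ∧ β < 1) (hδ : 0 < δ)
    (ha : 0 < a) (h0 : M (Iic 0) = 0)
    (hL : ∀ z : ℝ, 0 < z → ∫ w, Real.exp (-(z / w) ^ (1 / β)) ∂M = Real.exp (-z)) :
    ∃ c C : ℝ, 0 < c ∧ 0 < C ∧ ∀ R : ℝ, 1 ≤ R →
      ENNReal.ofReal (c * Real.exp (-(C * R ^ (1 / (α - β))))) ≤
        kernelMoment M δ (1 / (α - 1)) a R := by
  obtain ⟨c, C, K, hc, hC, hK, hlow⟩ := exists_le_measureReal_Ico hβ h0 hL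
  refine ⟨c, δ * K + a + C, hc, by positivity, fun R hR => ?_⟩
  have hR0 : 0 < R := by linarith
  have h1 : 0 < α - 1 := by linarith
  have h2 : 0 < 1 - β := by linarith [hβ.2]
  have h3 : 0 < α - β := by linarith
  set V := R ^ (1 / (α - β)) with hV
  have hV1 : 1 ≤ V := Real.one_le_rpow hR (by positivity)
  have hV0 : 0 < V := by linarith
  have hKV : 1 ≤ K * V := by nlinarith
  have hRV : R = V ^ (α - β) := by
    rw [hV, ← Real.rpow_mul hR0.le, one_div_mul_cancel h3.ne', Real.rpow_one]
  have hpt : ∀ w ∈ Ico (V ^ (1 - β)) ((K * V) ^ (1 - β)),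
      Real.exp (-((δ * K + a) * V)) ≤
        w ^ (1 - δ) * Real.exp (-(a * (R / w) ^ (1 / (α - 1)))) := by
    intro w hw
    have hw1 : 1 ≤ w := (Real.one_le_rpow hV1 h2.le).trans hw.1
    have hw0 : 0 < w := by linarith
    have hG : (R / w) ^ (1 / (α - 1)) ≤ V := by
      rw [one_div, Real.rpow_inv_le_iff_of_pos (by positivity) hV0.le h1, div_le_iff₀ hw0]
      calc R = V ^ (α - 1) * V ^ (1 - β) := by rw [← Real.rpow_add hV0, hRV]; ring_nf
        _ ≤ V ^ (α - 1) * w := by gcongr; exact hw.1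
    have hwK : w ≤ Real.exp (K * V) := by
      calc w ≤ (K * V) ^ (1 - β) := hw.2.le
        _ ≤ (K * V) ^ (1 : ℝ) := Real.rpow_le_rpow_of_exponent_le hKV (by linarith [hβ.1])
        _ = K * V := Real.rpow_one _
        _ ≤ Real.exp (K * V) := by linarith [Real.add_one_le_exp (K * V)]
    have hpow : Real.exp (-(δ * K * V)) ≤ w ^ (1 - δ) := by
      calc Real.exp (-(δ * K * V)) = Real.exp (K * V) ^ (-δ) := by
            rw [← Real.exp_mul]; ring_nf
        _ ≤ w ^ (-δ) := Real.rpow_le_rpow_of_nonpos hw0 hwK (by linarith)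
        _ ≤ w ^ (1 - δ) := Real.rpow_le_rpow_of_exponent_le hw1 (by linarith)
    calc Real.exp (-((δ * K + a) * V)) = Real.exp (-(δ * K * V)) * Real.exp (-(a * V)) := by
          rw [← Real.exp_add]; ring_nf
      _ ≤ _ := by gcongr
  refine le_trans ?_ (le_kernelMoment_of_le_on measurableSet_Ico hpt)
  have h4 := ENNReal.ofReal_le_ofReal (hlow V hV1)
  rw [ofReal_measureReal] at h4
  refine le_trans (le_of_eq ?_) (mul_le_mul_right h4 _)
  rw [← ENNReal.ofReal_mul (by positivity), mul_left_comm, ← Real.exp_add]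
  ring_nf

end FarBounds

theorem measure_Iic_zero_eq_zero_of_density {ν : Measure ℝ} {f : ℝ → ℝ≥0∞}
    (h : ∀ A : Set ℝ, MeasurableSet A → ν A = ∫⁻ t in A ∩ Ici 0, f t) : ν (Iic 0) = 0 := by
  rw [h _ measurableSet_Iic, Iic_inter_Ici, Icc_self]
  exact setLIntegral_measure_zero _ _ (by simp)

section InversePower

variable {β : ℝ} {ν : Measure ℝ}

theorem map_rpow_neg_Iic_zero (h0 : ν (Iic 0) = 0) : ν.map (fun s => s ^ (-β)) (Iic 0) = 0 := by
  rw [Measure.map_apply (by fun_prop) measurableSet_Iic]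
  refine measure_mono_null (fun s hs => ?_) h0
  by_contra h
  have hs0 : 0 < s := not_le.1 h
  exact (not_le.2 (Real.rpow_pos_of_pos hs0 (-β))) hs

theorem integral_exp_map_rpow_neg (hβ : 0 < β) (h0 : ν (Iic 0) = 0)
    (hlap : ∀ l : ℝ, 0 < l → ∫ s, Real.exp (-l * s) ∂ν = Real.exp (-1 * l ^ β))
    {z : ℝ} (hz : 0 < z) :
    ∫ w, Real.exp (-(z / w) ^ (1 / β)) ∂(ν.map fun s => s ^ (-β)) = Real.exp (-z) := by
  rw [integral_map (by fun_prop)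
    (by fun_prop : Measurable fun w : ℝ => Real.exp (-(z / w) ^ (1 / β))).aestronglyMeasurable]
  have h1 : ∫ s, Real.exp (-(z / s ^ (-β)) ^ (1 / β)) ∂ν =
      ∫ s, Real.exp (-(z ^ (1 / β)) * s) ∂ν := by
    refine integral_congr_ae ?_
    filter_upwards [ae_pos_of_measure_Iic_zero h0] with s hs
    rw [Real.rpow_neg hs.le, div_inv_eq_mul, Real.mul_rpow hz.le (by positivity),
      ← Real.rpow_mul hs.le, mul_one_div_cancel hβ.ne', Real.rpow_one, neg_mul]
  rw [h1, hlap _ (by positivity), ← Real.rpow_mul hz.le, one_div_mul_cancel hβ.ne',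
    Real.rpow_one, neg_one_mul]

end InversePower

theorem subGaussian_rescale {α β d a c t w ρ : ℝ} (hα : 1 < α) (ht : 0 < t)
    (hw : 0 < w) (hρ : 0 ≤ ρ) :
    β * t ^ (β - 1) * w * (c * (t ^ β * w) ^ (-(d / α)) *
        Real.exp (-(a * (ρ / (t ^ β * w) ^ (1 / α)) ^ (α / (α - 1))))) =
      β * c * t ^ (β - 1 - β * d / α) *
        (w ^ (1 - d / α) * Real.exp (-(a * (ρ ^ α / t ^ β / w) ^ (1 / (α - 1))))) := by
  have htβ : 0 < t ^ β := by positivity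
  have h1 : (ρ / (t ^ β * w) ^ (1 / α)) ^ (α / (α - 1)) =
      (ρ ^ α / t ^ β / w) ^ (1 / (α - 1)) := by
    rw [div_eq_mul_one_div α (α - 1), Real.rpow_mul (by positivity),
      Real.div_rpow hρ (by positivity), ← Real.rpow_mul (by positivity),
      one_div_mul_cancel (by linarith), Real.rpow_one, div_div]
  have h2 : t ^ (β - 1 - β * d / α) = t ^ (β - 1) * (t ^ β) ^ (-(d / α)) := by
    rw [← Real.rpow_mul ht.le, ← Real.rpow_add ht]
    ring_nf
  have h3 : w ^ (1 - d / α) = w * w ^ (-(d / α)) := by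
    rw [sub_eq_add_neg, Real.rpow_add hw, Real.rpow_one]
  rw [h1, h2, h3, Real.mul_rpow htβ.le hw.le]
  ring

theorem kernelMoment_le_lintegral {α β d a c t ρ : ℝ} {M : Measure ℝ} {F : ℝ → ℝ} (hα : 1 < α)
    (hβ : 0 < β) (hc : 0 < c) (ht : 0 < t) (hρ : 0 ≤ ρ) (h0 : M (Iic 0) = 0)
    (hF : ∀ r : ℝ, 0 < r →
      c * r ^ (-(d / α)) * Real.exp (-(a * (ρ / r ^ (1 / α)) ^ (α / (α - 1)))) ≤ F r) :
    ENNReal.ofReal (β * c * t ^ (β - 1 - β * d / α)) *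
        kernelMoment M (d / α) (1 / (α - 1)) a (ρ ^ α / t ^ β) ≤
      ∫⁻ w, ENNReal.ofReal (β * t ^ (β - 1) * w * F (t ^ β * w)) ∂M := by
  unfold kernelMoment
  rw [← lintegral_const_mul _ (by fun_prop)]
  refine lintegral_mono_ae ?_
  filter_upwards [ae_pos_of_measure_Iic_zero h0] with w hw
  rw [← ENNReal.ofReal_mul (by positivity), ← subGaussian_rescale hα ht hw hρ]
  refine ENNReal.ofReal_le_ofReal ?_
  have := hF (t ^ β * w) (by positivity)
  gcongr

theorem lintegral_le_kernelMoment {α β d a c t ρ : ℝ} {M : Measure ℝ} {F : ℝ → ℝ} (hα : 1 < α)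
    (hβ : 0 < β) (hc : 0 < c) (ht : 0 < t) (hρ : 0 ≤ ρ) (h0 : M (Iic 0) = 0)
    (hF : ∀ r : ℝ, 0 < r →
      F r ≤ c * r ^ (-(d / α)) * Real.exp (-(a * (ρ / r ^ (1 / α)) ^ (α / (α - 1))))) :
    ∫⁻ w, ENNReal.ofReal (β * t ^ (β - 1) * w * F (t ^ β * w)) ∂M ≤
      ENNReal.ofReal (β * c * t ^ (β - 1 - β * d / α)) *
        kernelMoment M (d / α) (1 / (α - 1)) a (ρ ^ α / t ^ β) := by
  unfold kernelMoment
  rw [← lintegral_const_mul _ (by fun_prop)]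
  refine lintegral_mono_ae ?_
  filter_upwards [ae_pos_of_measure_Iic_zero h0] with w hw
  rw [← ENNReal.ofReal_mul (by positivity), ← subGaussian_rescale hα ht hw hρ]
  refine ENNReal.ofReal_le_ofReal ?_
  have := hF (t ^ β * w) (by positivity)
  gcongr

theorem Hle_eq_mul_nearProfile {α β d t ρ : ℝ} (hα : 0 < α) (ht : 0 < t) (hρ : 0 < ρ) :
    Hle α β d t ρ = t ^ (β - 1 - β * d / α) * nearProfile (d / α) (ρ ^ α / t ^ β) := by
  have htβ : 0 < t ^ β := by positivity
  unfold Hle nearProfile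
  simp only [div_lt_iff₀ hα, div_eq_iff hα.ne']
  split_ifs with h1 h2
  · rw [mul_one]
  · have h3 : β - 1 - β * d / α = -1 - β := by
      rw [h2]
      field_simp
      ring
    rw [h3, div_div_eq_mul_div]
  · rw [Real.div_rpow (by positivity) htβ.le, ← Real.rpow_mul hρ.le, ← Real.rpow_mul ht.le,
      mul_div_left_comm, ← Real.rpow_sub ht]
    have h3 : α * (2 - d / α) = 2 * α - d := by field_simp
    have h4 : β - 1 - β * d / α - β * (2 - d / α) = -1 - β := by ring
    rw [h3, h4, mul_comm]

/-- Theorem 1.4(ii): β-stable time-change of a sub-Gaussian diffusion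
kernel on a `d`-regular space.  If
`p⁰(t,x,y) ≍ t^{−d/α} exp(−c (d(x,y)/t^{1/α})^{α/(α−1)})` with `α ≥ 2`, and
`q(t,x,y) = ∫₀^∞ p⁰(r,x,y) p̄(r,t) dr` with `p̄` the densities of a β-stable subordinator,
then `q(t,x,y) ≍ H_{≤1}(t,d(x,y))` for `d(x,y) ≤ t^{β/α}`, and
`q(t,x,y) ≍ t^{β−1−βd/α} exp(−c (d(x,y)^α/t^β)^{1/(α−β)})` (with two-sided constants)
for `d(x,y) ≥ t^{β/α}`. -/
theorem time_frac_stmt19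
    {E : Type*} [MetricSpace E] [MeasurableSpace E] [BorelSpace E]
    [TopologicalSpace.SeparableSpace E] [LocallyCompactSpace E]
    (μ : Measure E)
    (d : ℝ) (hd : 0 < d) (cμ : ℝ) (hcμ : 1 ≤ cμ)
    (hvol : ∀ (x : E) (r : ℝ), 0 < r →
      ENNReal.ofReal (cμ⁻¹ * r ^ d) ≤ μ (Metric.ball x r) ∧
      μ (Metric.ball x r) ≤ ENNReal.ofReal (cμ * r ^ d))
    (α β : ℝ) (hα : 2 ≤ α) (hβ : 0 < β ∧ β < 1)
    -- the β-stable subordinator marginals with continuous densities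
    (μr : ℝ → Measure ℝ)
    (hprob : ∀ r : ℝ, 0 < r → IsProbabilityMeasure (μr r))
    (hlap : ∀ r : ℝ, 0 < r → ∀ l : ℝ, 0 < l →
      ∫ s, Real.exp (-l * s) ∂(μr r) = Real.exp (-r * l ^ β))
    (pbar : ℝ → ℝ → ℝ)
    (hpbar_nn : ∀ r t : ℝ, 0 ≤ pbar r t)
    (hpbar_cont : ∀ r : ℝ, 0 < r → Continuous (pbar r))
    (hdens : ∀ r : ℝ, 0 < r → ∀ A : Set ℝ, MeasurableSet A →
      μr r A = ∫⁻ t in A ∩ Set.Ici 0, ENNReal.ofReal (pbar r t))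
    -- the sub-Gaussian two-sided estimate for p⁰
    (p0 : ℝ → E → E → ℝ)
    (hp0_nn : ∀ (r : ℝ) (x y : E), 0 ≤ p0 r x y)
    (hp0_meas : Measurable (fun z : ℝ × E × E => p0 z.1 z.2.1 z.2.2))
    (a₁ a₂ a₃ a₄ : ℝ) (ha : 0 < a₁ ∧ 0 < a₂ ∧ 0 < a₃ ∧ 0 < a₄)
    (hp0 : ∀ t : ℝ, 0 < t → ∀ x y : E,
      a₁ * t ^ (-(d / α)) *
          Real.exp (-(a₂ * (dist x y / t ^ (1/α)) ^ (α / (α - 1)))) ≤ p0 t x y ∧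
      p0 t x y ≤ a₃ * t ^ (-(d / α)) *
          Real.exp (-(a₄ * (dist x y / t ^ (1/α)) ^ (α / (α - 1)))))
    -- the fundamental solution q
    (q : ℝ → E → E → ℝ≥0∞)
    (hq : ∀ (t : ℝ) (x y : E),
      q t x y = ∫⁻ r in Set.Ioi (0:ℝ), ENNReal.ofReal (p0 r x y * pbar r t)) :
    (∃ C : ℝ, 1 ≤ C ∧
      ∀ t : ℝ, 0 < t → ∀ x y : E, x ≠ y → dist x y ≤ t ^ (β / α) →
        ENNReal.ofReal (C⁻¹ * Hle α β d t (dist x y)) ≤ q t x y ∧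
        q t x y ≤ ENNReal.ofReal (C * Hle α β d t (dist x y))) ∧
    (∃ C₁ C₂ C₃ C₄ : ℝ, 0 < C₁ ∧ 0 < C₂ ∧ 0 < C₃ ∧ 0 < C₄ ∧
      ∀ t : ℝ, 0 < t → ∀ x y : E, t ^ (β / α) ≤ dist x y →
        ENNReal.ofReal (C₁ * t ^ (β - 1 - β * d / α) *
            Real.exp (-(C₂ * (dist x y ^ α / t ^ β) ^ (1 / (α - β))))) ≤ q t x y ∧
        q t x y ≤ ENNReal.ofReal (C₃ * t ^ (β - 1 - β * d / α) *
            Real.exp (-(C₄ * (dist x y ^ α / t ^ β) ^ (1 / (α - β)))))) := by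
  obtain ⟨ha₁, ha₂, ha₃, ha₄⟩ := ha
  have hα1 : 1 < α := by linarith
  have hα0 : 0 < α := by linarith
  have hβ0 := hβ.1
  have hδ : 0 < d / α := by positivity
  have hγ : 0 < 1 / (α - 1) := div_pos one_pos (by linarith)
  have hν0 : μr 1 (Iic 0) = 0 := measure_Iic_zero_eq_zero_of_density (hdens 1 one_pos)
  have h0 := map_rpow_neg_Iic_zero (β := β) hν0
  have hL := fun (z : ℝ) (hz : 0 < z) =>
    integral_exp_map_rpow_neg hβ0 hν0 (hlap 1 one_pos) hz
  have := hprob 1 one_pos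
  set M := (μr 1).map fun s => s ^ (-β)
  have : IsProbabilityMeasure M := Measure.isProbabilityMeasure_map (by fun_prop)
  have hqM : ∀ t : ℝ, 0 < t → ∀ x y : E, q t x y =
      ∫⁻ w, ENNReal.ofReal (β * t ^ (β - 1) * w * p0 (t ^ β * w) x y) ∂M := fun t ht x y => by
    rw [hq]
    exact lintegral_stable_density hβ0 μr hprob hlap pbar hpbar_nn hpbar_cont hdens
      (fun r => p0 r x y) (hp0_meas.comp (by fun_prop : Measurable fun r : ℝ => (r, x, y))) ht
  have hlow : ∀ t : ℝ, 0 < t → ∀ x y : E,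
      ENNReal.ofReal (β * a₁ * t ^ (β - 1 - β * d / α)) *
        kernelMoment M (d / α) (1 / (α - 1)) a₂ (dist x y ^ α / t ^ β) ≤ q t x y := by
    intro t ht x y
    rw [hqM t ht]
    exact kernelMoment_le_lintegral hα1 hβ0 ha₁ ht dist_nonneg h0 fun r hr => (hp0 r hr x y).1
  have hupp : ∀ t : ℝ, 0 < t → ∀ x y : E,
      q t x y ≤ ENNReal.ofReal (β * a₃ * t ^ (β - 1 - β * d / α)) *
        kernelMoment M (d / α) (1 / (α - 1)) a₄ (dist x y ^ α / t ^ β) := by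
    intro t ht x y
    rw [hqM t ht]
    exact lintegral_le_kernelMoment hα1 hβ0 ha₃ ht dist_nonneg h0 fun r hr => (hp0 r hr x y).2
  have hpow : ∀ t : ℝ, 0 < t → (t ^ (β / α)) ^ α = t ^ β := fun t ht => by
    rw [← Real.rpow_mul ht.le, div_mul_cancel₀ _ hα0.ne']
  constructor
  · obtain ⟨c, hc, hnl⟩ := exists_kernelMoment_near_lower hβ hδ hγ ha₂ h0 hL
    obtain ⟨C, hC, hnu⟩ := exists_kernelMoment_near_upper hβ hδ hγ ha₄ h0 hL
    set B := max 1 (max (β * a₃ * C) (β * a₁ * c)⁻¹)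
    have hB1 : 1 ≤ B := le_max_left _ _
    have hB2 : β * a₃ * C ≤ B := (le_max_left _ _).trans (le_max_right _ _)
    have hB3 : B⁻¹ ≤ β * a₁ * c :=
      inv_le_of_inv_le₀ (by positivity) ((le_max_right _ _).trans (le_max_right _ _))
    refine ⟨B, hB1, fun t ht x y hxy hdist => ?_⟩
    have hρ : 0 < dist x y := dist_pos.2 hxy
    have hR : 0 < dist x y ^ α / t ^ β := by positivity
    have hR1 : dist x y ^ α / t ^ β ≤ 1 := by
      rw [div_le_one (by positivity), ← hpow t ht]
      gcongr
    have hP : 0 < nearProfile (d / α) (dist x y ^ α / t ^ β) :=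
      (Real.log_pos one_lt_two).trans_le (log_two_le_nearProfile hR hR1)
    rw [Hle_eq_mul_nearProfile hα0 ht hρ]
    constructor
    · refine le_trans ?_ ((mul_le_mul_right (hnl _ hR hR1) _).trans (hlow t ht x y))
      rw [← ENNReal.ofReal_mul (by positivity)]
      refine ENNReal.ofReal_le_ofReal ?_
      rw [mul_mul_mul_comm]
      gcongr
    · refine ((hupp t ht x y).trans (mul_le_mul_right (hnu _ hR hR1) _)).trans ?_
      rw [← ENNReal.ofReal_mul (by positivity)]
      refine ENNReal.ofReal_le_ofReal ?_
      rw [mul_mul_mul_comm]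
      gcongr
  · obtain ⟨c, C, hc, hC, hfl⟩ := exists_kernelMoment_far_lower hα1 hβ hδ ha₂ h0 hL
    obtain ⟨C', c', hC', hc', hfu⟩ := exists_kernelMoment_far_upper hα1 hβ hδ ha₄ h0 hL
    refine ⟨β * a₁ * c, C, β * a₃ * C', c', by positivity, hC, by positivity, hc',
      fun t ht x y hdist => ?_⟩
    have hR1 : 1 ≤ dist x y ^ α / t ^ β := by
      rw [one_le_div (by positivity), ← hpow t ht]
      gcongr
    constructor
    · refine le_trans (le_of_eq ?_) ((mul_le_mul_right (hfl _ hR1) _).trans (hlow t ht x y))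
      rw [← ENNReal.ofReal_mul (by positivity)]
      ring_nf
    · refine ((hupp t ht x y).trans (mul_le_mul_right (hfu _ hR1) _)).trans (le_of_eq ?_)
      rw [← ENNReal.ofReal_mul (by positivity)]
      ring_nf
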